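/- There is an absolute constant c > 0 with the following property. Let (R, C, f_r, f_c) be a two-player penalty game whose penalty function f_r : Δⁿ → ℝ is λ-Lipschitz with respect to the L_p norm for some 2 ≤ p < ∞ and λ > 0, let y ∈ Δⁿ, and let x̂ ∈ Δⁿ be a best response of the row player against y, i.e. a maximizer of T_r(·, y) over Δⁿ. Then for every 0 < ε < 1 and every integer l ≥ c·p·λ²/ε², there exists an l-uniform strategy x' ∈ Δⁿ such that T_r(x̂, y) − T_r(x', y) ≤ ε. -/

import Mathlib

open Finset Matrix

/-- The `L_p` norm of a vector in `ℝ^n` (for a real exponent `p`). -/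
noncomputable def lpNorm {n : ℕ} (p : ℝ) (x : Fin n → ℝ) : ℝ :=
  (∑ i, |x i| ^ p) ^ (1 / p)

/-- Row player's utility in a two-player penalty game: `xᵀRy − f_r(x)`. -/
noncomputable def Tr {n : ℕ} (R : Matrix (Fin n) (Fin n) ℝ) (fr : (Fin n → ℝ) → ℝ)
    (x y : Fin n → ℝ) : ℝ := x ⬝ᵥ R.mulVec y - fr x

/-- A strategy is `l`-uniform if it is a uniform average of `l` pure strategies
(repetitions allowed). -/
def kUniform {n : ℕ} (l : ℕ) (x : Fin n → ℝ) : Prop :=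
  ∃ v : Fin l → Fin n, x = (l : ℝ)⁻¹ • ((∑ t, Pi.single (v t) 1 : Fin n → ℝ))

/-- A point of the standard simplex averages `g` to a value no smaller than some `g i`. -/
lemma exists_le_dotProduct_of_mem_stdSimplex {ι : Type*} [Fintype ι] {x : ι → ℝ}
    (hx : x ∈ stdSimplex ℝ ι) (g : ι → ℝ) : ∃ i, g i ≤ x ⬝ᵥ g := by
  by_contra! h
  obtain ⟨i, hi⟩ : ∃ i, 0 < x i := by
    by_contra! h0
    have := Finset.sum_nonpos (s := Finset.univ) fun i _ => h0 i
    linarith [hx.2]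
  have hlt : ∑ k, x k * (x ⬝ᵥ g) < ∑ k, x k * g k :=
    Finset.sum_lt_sum (fun k _ => mul_le_mul_of_nonneg_left (h k).le (hx.1 k))
      ⟨i, Finset.mem_univ i, mul_lt_mul_of_pos_left (h i) hi⟩
  rw [← Finset.sum_mul, hx.2, one_mul] at hlt
  exact lt_irrefl _ hlt

/-- For `x` in the simplex, the vertices `e i` satisfy, for some `i`, an upper bound on an affine
plus quadratic function of `x - e i` by its average. -/
lemma exists_linear_add_quadratic_sub_single_le {ι : Type*} [Fintype ι] [DecidableEq ι]
    {x : ι → ℝ} (hx : x ∈ stdSimplex ℝ ι) (b : ι → ℝ) {K : ℝ} (hK : 0 ≤ K) :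
    ∃ i, b ⬝ᵥ (x - Pi.single i 1) + K * ((x - Pi.single i 1) ⬝ᵥ (x - Pi.single i 1)) ≤ K := by
  obtain ⟨i, hi⟩ := exists_le_dotProduct_of_mem_stdSimplex hx
    fun i => b ⬝ᵥ (x - Pi.single i 1) + K * ((x - Pi.single i 1) ⬝ᵥ (x - Pi.single i 1))
  refine ⟨i, hi.trans ?_⟩
  have expand : ∀ k, x k * (b ⬝ᵥ (x - Pi.single k 1) +
      K * ((x - Pi.single k 1) ⬝ᵥ (x - Pi.single k 1))) =
      x k * (b ⬝ᵥ x + K * (x ⬝ᵥ x) + K) - b k * x k - 2 * K * (x k * x k) := fun k => by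
    simp only [dotProduct_sub, sub_dotProduct, dotProduct_single, single_dotProduct,
      mul_one, one_mul, Pi.sub_apply, Pi.single_eq_same]
    ring
  have hnn : 0 ≤ x ⬝ᵥ x := Finset.sum_nonneg fun k _ => mul_self_nonneg (x k)
  calc _ = (b ⬝ᵥ x + K * (x ⬝ᵥ x) + K) - b ⬝ᵥ x - 2 * K * (x ⬝ᵥ x) := by
        rw [dotProduct, Finset.sum_congr rfl fun k _ => expand k, Finset.sum_sub_distrib,
          Finset.sum_sub_distrib, ← Finset.sum_mul, hx.2, one_mul, ← Finset.mul_sum]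
        rfl
    _ ≤ K := by nlinarith [mul_nonneg hK hnn]

/-- Derandomized sampling: `l` vertices can be chosen so that the total deviation from `x` has
a controlled linear plus quadratic cost. -/
lemma exists_linear_add_quadratic_sum_sub_single_le {ι : Type*} [Fintype ι] [DecidableEq ι]
    {x : ι → ℝ} (hx : x ∈ stdSimplex ℝ ι) (a : ι → ℝ) {K : ℝ} (hK : 0 ≤ K) (l : ℕ) :
    ∃ v : Fin l → ι, a ⬝ᵥ (∑ t, (x - Pi.single (v t) 1)) +
      K * ((∑ t, (x - Pi.single (v t) 1)) ⬝ᵥ (∑ t, (x - Pi.single (v t) 1))) ≤ l * K := by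
  induction l with
  | zero => exact ⟨Fin.elim0, by simp⟩
  | succ l ih =>
    obtain ⟨v, hv⟩ := ih
    set S : ι → ℝ := ∑ t, (x - Pi.single (v t) 1)
    obtain ⟨i, hi⟩ := exists_linear_add_quadratic_sub_single_le hx (a + (2 * K) • S) hK
    refine ⟨Fin.snoc v i, ?_⟩
    simp only [Fin.sum_univ_castSucc, Fin.snoc_castSucc, Fin.snoc_last]
    change a ⬝ᵥ (S + _) + K * ((S + _) ⬝ᵥ (S + _)) ≤ _
    set d : ι → ℝ := x - Pi.single i 1
    rw [add_dotProduct, smul_dotProduct, smul_eq_mul] at hi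
    simp only [dotProduct_add, add_dotProduct, dotProduct_comm d S]
    push_cast
    linarith

/-- For `2 ≤ p`, the `L_p` norm is at most the Euclidean norm. -/
lemma lpNorm_le_sqrt_dotProduct_self {n : ℕ} {p : ℝ} (hp : 2 ≤ p) (z : Fin n → ℝ) :
    lpNorm p z ≤ √(z ⬝ᵥ z) := by
  set s := √(z ⬝ᵥ z)
  have hs : 0 ≤ s := Real.sqrt_nonneg _
  have hss : s ^ 2 = z ⬝ᵥ z :=
    Real.sq_sqrt (Finset.sum_nonneg fun i _ => mul_self_nonneg (z i))
  have hz : ∀ i, |z i| ≤ s := fun i => by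
    refine abs_le_of_sq_le_sq ?_ hs
    rw [hss, sq]
    exact Finset.single_le_sum (f := fun i => z i * z i)
      (fun i _ => mul_self_nonneg (z i)) (Finset.mem_univ i)
  have split : ∀ r : ℝ, 0 ≤ r → r ^ p = r ^ 2 * r ^ (p - 2) := fun r hr => by
    rw [← Real.rpow_two, ← Real.rpow_add_of_nonneg hr (by norm_num) (by linarith)]
    congr 1
    ring
  have hsum : ∑ i, |z i| ^ p ≤ s ^ p := by
    rw [split s hs, hss, dotProduct, Finset.sum_mul]
    refine Finset.sum_le_sum fun i _ => ?_
    rw [split _ (abs_nonneg _), sq_abs, sq]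
    exact mul_le_mul_of_nonneg_left
      (Real.rpow_le_rpow (abs_nonneg _) (hz i) (by linarith)) (mul_self_nonneg _)
  calc lpNorm p z ≤ (s ^ p) ^ (1 / p) := Real.rpow_le_rpow
        (Finset.sum_nonneg fun i _ => Real.rpow_nonneg (abs_nonneg _) _) hsum (by positivity)
    _ = s := by rw [one_div, Real.rpow_rpow_inv hs (by linarith)]

/-- The uniform average of `l > 0` pure strategies lies in the simplex. -/
lemma inv_smul_sum_single_mem_stdSimplex {ι : Type*} [Fintype ι] [DecidableEq ι] {l : ℕ}
    (hl : 0 < l) (v : Fin l → ι) :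
    (l : ℝ)⁻¹ • (∑ t, Pi.single (v t) 1 : ι → ℝ) ∈ stdSimplex ℝ ι := by
  rw [Finset.smul_sum]
  exact (convex_stdSimplex ℝ ι).sum_mem (fun _ _ => by positivity)
    (by simp [hl.ne']) fun t _ => single_mem_stdSimplex ℝ (v t)

/-- there is an absolute constant `c > 0` such that in every penalty game with a
`λ_p`-Lipschitz row penalty function, for any `y ∈ Δⁿ`, any best response `x̂` against `y`,
any `0 < ε < 1` and any `l ≥ c·pλ²/ε²`, there is an `l`-uniform `ε`-best response. -/
theorem penalty_game_kUniform_approx_best_response :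
    ∃ c : ℝ, 0 < c ∧
      ∀ (n : ℕ) (R C : Matrix (Fin n) (Fin n) ℝ),
        (∀ i j, R i j ∈ Set.Icc (0 : ℝ) 1) → (∀ i j, C i j ∈ Set.Icc (0 : ℝ) 1) →
        ∀ (fr fc : (Fin n → ℝ) → ℝ) (p lam : ℝ), 2 ≤ p → 0 < lam →
        (∀ x ∈ stdSimplex ℝ (Fin n), ∀ y ∈ stdSimplex ℝ (Fin n),
          |fr x - fr y| ≤ lam * lpNorm p (x - y)) →
        ∀ y ∈ stdSimplex ℝ (Fin n),
        ∀ xhat ∈ stdSimplex ℝ (Fin n),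
        (∀ x ∈ stdSimplex ℝ (Fin n), Tr R fr x y ≤ Tr R fr xhat y) →
        ∀ ε : ℝ, 0 < ε → ε < 1 →
        ∀ l : ℕ, c * p * lam ^ 2 / ε ^ 2 ≤ l →
        ∃ x' ∈ stdSimplex ℝ (Fin n),
          kUniform l x' ∧ Tr R fr xhat y - Tr R fr x' y ≤ ε := by
  refine ⟨1, one_pos, ?_⟩
  intro n R _ _ _ fr _ p lam hp hlam hlip y _ xhat hx _ ε hε _ l hl
  have hlR : 0 < (l : ℝ) := lt_of_lt_of_le (by positivity) hl
  have hle : lam ^ 2 ≤ l * ε ^ 2 := by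
    rw [div_le_iff₀ (by positivity)] at hl
    nlinarith [sq_nonneg lam]
  obtain ⟨v, hv⟩ := exists_linear_add_quadratic_sum_sub_single_le hx (R.mulVec y)
    (K := lam ^ 2 / (2 * ε * l)) (by positivity) l
  set S : Fin n → ℝ := ∑ t, (xhat - Pi.single (v t) 1) with hS
  set x' : Fin n → ℝ := (l : ℝ)⁻¹ • (∑ t, Pi.single (v t) 1 : Fin n → ℝ) with hx'
  have hmem : x' ∈ stdSimplex ℝ (Fin n) :=
    inv_smul_sum_single_mem_stdSimplex (Nat.cast_pos.mp hlR) v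
  refine ⟨x', hmem, ⟨v, rfl⟩, ?_⟩
  have hdiff : S = (l : ℝ) • (xhat - x') := by
    rw [hS, Finset.sum_sub_distrib, smul_sub, hx', smul_inv_smul₀ hlR.ne']
    simp [← Nat.cast_smul_eq_nsmul ℝ]
  have hlin : Tr R fr xhat y - Tr R fr x' y =
      R.mulVec y ⬝ᵥ (xhat - x') + (fr x' - fr xhat) := by
    rw [dotProduct_comm, sub_dotProduct, Tr, Tr]
    ring
  have hfr : fr x' - fr xhat ≤ lam * √((xhat - x') ⬝ᵥ (xhat - x')) :=
    calc fr x' - fr xhat ≤ |fr xhat - fr x'| := by rw [abs_sub_comm]; exact le_abs_self _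
      _ ≤ lam * lpNorm p (xhat - x') := hlip _ hx _ hmem
      _ ≤ _ := mul_le_mul_of_nonneg_left (lpNorm_le_sqrt_dotProduct_self hp _) hlam.le
  rw [hdiff] at hv
  set z := xhat - x'
  set s := √(z ⬝ᵥ z)
  have hss : z ⬝ᵥ z = s ^ 2 :=
    (Real.sq_sqrt (Finset.sum_nonneg fun i _ => mul_self_nonneg (z i))).symm
  simp only [dotProduct_smul, smul_dotProduct, smul_eq_mul, hss] at hv
  have hquad : R.mulVec y ⬝ᵥ z + lam ^ 2 * s ^ 2 / (2 * ε) ≤ lam ^ 2 / (2 * ε * l) := by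
    refine le_of_mul_le_mul_left ?_ hlR
    refine le_trans (le_of_eq ?_) hv
    field_simp
  have hbound : lam ^ 2 / (2 * ε * l) ≤ ε / 2 := by
    rw [div_le_div_iff₀ (by positivity) two_pos]
    nlinarith
  have hamgm : lam * s ≤ ε / 2 + lam ^ 2 * s ^ 2 / (2 * ε) := by
    have : ε / 2 + lam ^ 2 * s ^ 2 / (2 * ε) - lam * s = (ε - lam * s) ^ 2 / (2 * ε) := by
      field_simp
      ring
    have : 0 ≤ (ε - lam * s) ^ 2 / (2 * ε) := by positivity
    linarith
  linarith
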